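/- arXiv:1511.02667 — 4 statements merged into one kernel-verified Lean document; each statement's English description precedes it below -/
import Mathlib

section
/- Proposition 3.4 (part 2): Let 𝓕 be a symmetric third-order tensor on ℝⁿ with trilinear form F, and let G be the modification trilinear form built from the vectors ē_i = (1/3)𝟙 + (2/3)e_i. If α ≥ (27/4)·max_{1≤i≤n} sqrt(Σ_{j,k=1}^n (𝓕_{ijk})²), then for every assignment vector x ∈ M and every y ∈ ℝⁿ one has F(x,y,y) + α·G(x,y,y) ≥ 0; equivalently, the Hessian of the modified score function S_α(x) = F(x,x,x) + α·G(x,x,x) is positive semidefinite at every x ∈ M. -/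
open Finset

/-- The trilinear form associated to a third-order tensor `𝓕` indexed by a finite type. -/
def triForm {ι : Type*} [Fintype ι] (𝓕 : ι → ι → ι → ℝ) (x y z : ι → ℝ) : ℝ :=
  ∑ i, ∑ j, ∑ k, 𝓕 i j k * x i * y j * z k

/-- The perturbed basis vector `e_i^ε = ε·𝟙 + (1−ε)·e_i`. -/
def epsVec {ι : Type*} [DecidableEq ι] (ε : ℝ) (i : ι) : ι → ℝ :=
  fun j => ε + (1 - ε) * (if j = i then 1 else 0)

/-- The modification trilinear form
`G_ε(x,y,z) = ∑_i ⟨e_i^ε, x⟩ ⟨e_i^ε, y⟩ ⟨e_i^ε, z⟩`. -/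
def Geps {ι : Type*} [Fintype ι] [DecidableEq ι] (ε : ℝ) (x y z : ι → ℝ) : ℝ :=
  ∑ i, (∑ j, epsVec ε i j * x j) * (∑ j, epsVec ε i j * y j) * (∑ j, epsVec ε i j * z j)

/-- The set of assignment matrices `M`, viewed as binary vectors indexed by
`Fin n₁ × Fin n₂`: every row sums to `1` and every column sums to at most `1`. -/
def assignSet (n₁ n₂ : ℕ) : Set (Fin n₁ × Fin n₂ → ℝ) :=
  {x | (∀ p, x p = 0 ∨ x p = 1) ∧ (∀ i, ∑ j, x (i, j) = 1) ∧ (∀ j, ∑ i, x (i, j) ≤ 1)}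

lemma epsVec_inner {ι : Type*} [Fintype ι] [DecidableEq ι] (i : ι) (x : ι → ℝ) :
    ∑ j, epsVec (1 / 3) i j * x j = (1 / 3) * ∑ j, x j + (2 / 3) * x i := by
  have h : ∀ j, epsVec (1 / 3) i j * x j
      = (1 / 3) * x j + (2 / 3) * (if j = i then x j else 0) := by
    intro j
    unfold epsVec
    split_ifs <;> ring
  rw [Finset.sum_congr rfl (fun j _ => h j), Finset.sum_add_distrib, ← Finset.mul_sum,
    ← Finset.mul_sum]
  simp

lemma quad_sum_bound {ι : Type*} [Fintype ι] (y : ι → ℝ) :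
    (4 / 9) * ∑ i, y i ^ 2 ≤ ∑ i, ((1 / 3) * ∑ j, y j + (2 / 3) * y i) ^ 2 := by
  set t := ∑ j, y j with ht
  have h : ∀ t : ℝ, ∑ i, ((1 / 3) * t + (2 / 3) * y i) ^ 2
      = ∑ i : ι, (t ^ 2 / 9) + (4 / 9 * t) * ∑ i, y i + (4 / 9) * ∑ i, y i ^ 2 := by
    intro t
    rw [Finset.mul_sum, Finset.mul_sum, ← Finset.sum_add_distrib, ← Finset.sum_add_distrib]
    refine Finset.sum_congr rfl fun i _ => ?_
    ring
  rw [h t, ← ht]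
  have h1 : 0 ≤ ∑ i : ι, (t ^ 2 / 9) := Finset.sum_nonneg fun i _ => by positivity
  nlinarith [sq_nonneg t]

lemma bilin_bound {ι : Type*} [Fintype ι] (A : ι → ι → ℝ) (y : ι → ℝ) :
    -(Real.sqrt (∑ j, ∑ k, A j k ^ 2) * ∑ i, y i ^ 2) ≤ ∑ j, ∑ k, A j k * y j * y k := by
  have hcs := Finset.sum_mul_sq_le_sq_mul_sq (Finset.univ : Finset (ι × ι))
    (fun p => A p.1 p.2) (fun p => y p.1 * y p.2)
  simp only [Fintype.sum_prod_type] at hcs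
  have h2 : ∑ j, ∑ k, (y j * y k) ^ 2 = (∑ i, y i ^ 2) ^ 2 := by
    rw [sq (∑ i, y i ^ 2), Finset.sum_mul_sum]
    simp only [mul_pow]
  have h3 : ∑ j, ∑ k, A j k * (y j * y k) = ∑ j, ∑ k, A j k * y j * y k := by
    simp only [mul_assoc]
  rw [h2, h3] at hcs
  have hA : 0 ≤ ∑ j, ∑ k, A j k ^ 2 :=
    Finset.sum_nonneg fun _ _ => Finset.sum_nonneg fun _ _ => sq_nonneg _
  have hy : 0 ≤ ∑ i, y i ^ 2 := Finset.sum_nonneg fun _ _ => sq_nonneg _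
  refine (abs_le_of_sq_le_sq' ?_ (by positivity)).1
  rw [mul_pow, Real.sq_sqrt hA]
  exact hcs

lemma main_bound {ι : Type*} [Fintype ι] [DecidableEq ι] (𝓕 : ι → ι → ι → ℝ) (m α : ℝ)
    (hm0 : 0 ≤ m) (hm : ∀ i, Real.sqrt (∑ j, ∑ k, (𝓕 i j k) ^ 2) ≤ m)
    (hα : (27 / 4) * m ≤ α) (x y : ι → ℝ) (hx : ∀ i, 0 ≤ x i) :
    0 ≤ triForm 𝓕 x y y + α * Geps (1 / 3) x y y := by
  set Y := ∑ i, y i ^ 2 with hY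
  set s := ∑ i, x i with hs
  have hY0 : 0 ≤ Y := Finset.sum_nonneg fun _ _ => sq_nonneg _
  have hs0 : 0 ≤ s := Finset.sum_nonneg fun i _ => hx i
  have hF : -(s * (m * Y)) ≤ triForm 𝓕 x y y := by
    unfold triForm
    rw [hs, Finset.sum_mul, ← Finset.sum_neg_distrib]
    refine Finset.sum_le_sum fun i _ => ?_
    have h1 : ∑ j, ∑ k, 𝓕 i j k * x i * y j * y k
        = x i * ∑ j, ∑ k, 𝓕 i j k * y j * y k := by
      simp only [Finset.mul_sum]
      refine Finset.sum_congr rfl fun j _ => Finset.sum_congr rfl fun k _ => ?_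
      ring
    rw [h1]
    have h2 := bilin_bound (𝓕 i) y
    have h3 := mul_le_mul_of_nonneg_right (hm i) hY0
    have h4 := mul_le_mul_of_nonneg_left
      (show -(m * Y) ≤ ∑ j, ∑ k, 𝓕 i j k * y j * y k by rw [← hY] at h2; linarith) (hx i)
    linarith
  have hG : (4 / 27) * (s * Y) ≤ Geps (1 / 3) x y y := by
    unfold Geps
    simp only [epsVec_inner]
    have h1 := mul_le_mul_of_nonneg_left (quad_sum_bound y) (show 0 ≤ s / 3 by positivity)
    have h2 : s / 3 * ∑ i, ((1 / 3) * ∑ j, y j + (2 / 3) * y i) ^ 2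
        ≤ ∑ i, ((1 / 3) * ∑ j, x j + (2 / 3) * x i) * ((1 / 3) * ∑ j, y j + (2 / 3) * y i)
          * ((1 / 3) * ∑ j, y j + (2 / 3) * y i) := by
      rw [Finset.mul_sum]
      refine Finset.sum_le_sum fun i _ => ?_
      rw [mul_assoc, ← sq]
      refine mul_le_mul_of_nonneg_right ?_ (sq_nonneg _)
      have := hx i
      linarith
    linarith
  have hα0 : 0 ≤ α := by linarith
  have hsY : 0 ≤ s * Y := mul_nonneg hs0 hY0
  have h5 := mul_le_mul_of_nonneg_left hG hα0
  have h6 := mul_le_mul_of_nonneg_right hα hsY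
  linarith

/-- Proposition 3.4 (part 2): for a symmetric third-order tensor `𝓕`, `G = G_{1/3}` and
`α ≥ (27/4)·max_i sqrt(∑_{j,k} 𝓕_{ijk}²)`, one has `F(x,y,y) + α·G(x,y,y) ≥ 0` for every
assignment vector `x ∈ M` and every `y ∈ ℝⁿ` (i.e. the Hessian of the modified score
function `S_α` is positive semidefinite at every point of `M`). -/
theorem prop34_part2 {n₁ n₂ : ℕ} (h₁ : 1 ≤ n₁) (h₁₂ : n₁ ≤ n₂)
    (𝓕 : (Fin n₁ × Fin n₂) → (Fin n₁ × Fin n₂) → (Fin n₁ × Fin n₂) → ℝ)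
    (hsym₁ : ∀ i j k, 𝓕 i j k = 𝓕 j i k)
    (hsym₂ : ∀ i j k, 𝓕 i j k = 𝓕 i k j)
    (α : ℝ)
    (hα : (27 / 4) *
        (Finset.univ.sup'
          (Finset.univ_nonempty_iff.mpr ⟨(⟨0, h₁⟩, ⟨0, h₁.trans h₁₂⟩)⟩)
          fun i => Real.sqrt (∑ j, ∑ k, (𝓕 i j k) ^ 2)) ≤ α) :
    ∀ x ∈ assignSet n₁ n₂, ∀ y : Fin n₁ × Fin n₂ → ℝ,
      0 ≤ triForm 𝓕 x y y + α * Geps (1 / 3) x y y := by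
  intro x hx y
  refine main_bound 𝓕 _ α ?_ ?_ hα x y ?_
  · exact (Real.sqrt_nonneg _).trans (Finset.le_sup'
      (fun i => Real.sqrt (∑ j, ∑ k, (𝓕 i j k) ^ 2))
      (Finset.mem_univ ((⟨0, h₁⟩, ⟨0, h₁.trans h₁₂⟩) : Fin n₁ × Fin n₂)))
  · intro i
    exact Finset.le_sup' (fun i => Real.sqrt (∑ j, ∑ k, (𝓕 i j k) ^ 2)) (Finset.mem_univ i)
  · intro i
    rcases hx.1 i with h | h <;> rw [h] <;> norm_num
end

section
/- Proposition 3.8 (part 3): Let 𝓕 be a symmetric third-order tensor on ℝⁿ with trilinear form F and score function S(x) = F(x,x,x), let G be the modification trilinear form built from the vectors ē_i = (1/3)𝟙 + (2/3)e_i, and set S_α(x) = F(x,x,x) + α·G(x,x,x). Then for every α ∈ ℝ there exists a constant c (depending only on α, n and n₁) such that S_α(x) = S(x) + c for all x ∈ M; consequently argmax_{x ∈ M} S_α(x) = argmax_{x ∈ M} S(x). -/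
open Finset

/-- On `M` the form `G(x,x,x)` takes a constant value. -/
theorem Geps_on_assignSet {n₁ n₂ : ℕ} (x : Fin n₁ × Fin n₂ → ℝ) (hx : x ∈ assignSet n₁ n₂) :
    Geps (1 / 3) x x x = (n₁ * n₂ : ℝ) * ((n₁ : ℝ) / 3) ^ 3 +
      n₁ * (((n₁ : ℝ) / 3 + 2 / 3) ^ 3 - ((n₁ : ℝ) / 3) ^ 3) := by
  obtain ⟨hb, hr, -⟩ := hx
  have hsum : ∑ p, x p = (n₁ : ℝ) := by
    rw [Fintype.sum_prod_type]
    simp [hr]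
  have hin : ∀ i, ∑ j, epsVec (1 / 3) i j * x j = (n₁ : ℝ) / 3 + 2 / 3 * x i := by
    intro i
    simp only [epsVec, add_mul, Finset.sum_add_distrib, ← Finset.mul_sum, hsum, mul_assoc,
      ite_mul, one_mul, zero_mul, Finset.sum_ite_eq', Finset.mem_univ, if_true]
    simp
    ring
  have hc : ∀ i, ((n₁ : ℝ) / 3 + 2 / 3 * x i) * ((n₁ : ℝ) / 3 + 2 / 3 * x i) *
      ((n₁ : ℝ) / 3 + 2 / 3 * x i) = ((n₁ : ℝ) / 3) ^ 3 +
      x i * (((n₁ : ℝ) / 3 + 2 / 3) ^ 3 - ((n₁ : ℝ) / 3) ^ 3) := by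
    intro i
    rcases hb i with h | h <;> rw [h] <;> ring
  simp only [Geps, hin, hc, Finset.sum_add_distrib, ← Finset.sum_mul, hsum]
  simp

/-- Proposition 3.8 (part 3): with `S(x) = F(x,x,x)`, `G = G_{1/3}` and
`S_α(x) = S(x) + α·G(x,x,x)`, for every `α ∈ ℝ` the added term `α·G(x,x,x)` is a constant
`c` on `M`, hence `argmax_{x ∈ M} S_α(x) = argmax_{x ∈ M} S(x)`. -/
theorem prop38_part3 {n₁ n₂ : ℕ} (h₁ : 1 ≤ n₁) (h₁₂ : n₁ ≤ n₂)
    (𝓕 : (Fin n₁ × Fin n₂) → (Fin n₁ × Fin n₂) → (Fin n₁ × Fin n₂) → ℝ)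
    (hsym₁ : ∀ i j k, 𝓕 i j k = 𝓕 j i k)
    (hsym₂ : ∀ i j k, 𝓕 i j k = 𝓕 i k j)
    (α : ℝ) :
    (∃ c : ℝ, ∀ x ∈ assignSet n₁ n₂,
        triForm 𝓕 x x x + α * Geps (1 / 3) x x x = triForm 𝓕 x x x + c) ∧
    {x ∈ assignSet n₁ n₂ | ∀ y ∈ assignSet n₁ n₂,
        triForm 𝓕 y y y + α * Geps (1 / 3) y y y ≤
          triForm 𝓕 x x x + α * Geps (1 / 3) x x x}
      = {x ∈ assignSet n₁ n₂ | ∀ y ∈ assignSet n₁ n₂,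
          triForm 𝓕 y y y ≤ triForm 𝓕 x x x} := by
  refine ⟨⟨α * ((n₁ * n₂ : ℝ) * ((n₁ : ℝ) / 3) ^ 3 +
      n₁ * (((n₁ : ℝ) / 3 + 2 / 3) ^ 3 - ((n₁ : ℝ) / 3) ^ 3)), ?_⟩, ?_⟩
  · intro x hx
    rw [Geps_on_assignSet x hx]
  · ext x
    simp only [Set.mem_setOf_eq]
    refine and_congr_right fun hx => forall₂_congr fun y hy => ?_
    rw [Geps_on_assignSet x hx, Geps_on_assignSet y hy]
    exact add_le_add_iff_right _
end

section
/- General-ε convexification bound (established in the proof of Proposition 3.4): let 𝓕 be a symmetric third-order tensor on ℝⁿ with trilinear form F, let 0 < ε < 1, and suppose α ≥ (1/(ε(1−ε)²))·max_{1≤i≤n} sqrt(Σ_{j,k=1}^n (𝓕_{ijk})²). Then F(x,y,y) + α·G_ε(x,y,y) ≥ 0 for every assignment vector x ∈ M and every y ∈ ℝⁿ. -/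
open Finset

theorem triForm_ge {ι : Type*} [Fintype ι] (𝓕 : ι → ι → ι → ℝ) (x y : ι → ℝ) (m : ℝ)
    (hx : ∀ i, 0 ≤ x i) (hm : ∀ i, Real.sqrt (∑ j, ∑ k, (𝓕 i j k) ^ 2) ≤ m) :
    -(m * ((∑ i, x i) * ∑ j, y j ^ 2)) ≤ triForm 𝓕 x y y := by
  have key : ∀ i, -(m * ∑ j, y j ^ 2) ≤ ∑ j, ∑ k, 𝓕 i j k * (y j * y k) := by
    intro i
    have hN : 0 ≤ ∑ j, y j ^ 2 := Finset.sum_nonneg fun i _ => sq_nonneg _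
    have cs := Finset.sum_mul_sq_le_sq_mul_sq (Finset.univ : Finset (ι × ι))
      (fun p => 𝓕 i p.1 p.2) (fun p => y p.1 * y p.2)
    simp only [Fintype.sum_prod_type] at cs
    have e : ∑ j, ∑ k, (y j * y k) ^ 2 = (∑ j, y j ^ 2) ^ 2 := by
      rw [sq (∑ j, y j ^ 2), Finset.sum_mul_sum]
      simp only [mul_pow]
    rw [e] at cs
    have hS : 0 ≤ ∑ j, ∑ k, (𝓕 i j k) ^ 2 :=
      Finset.sum_nonneg fun _ _ => Finset.sum_nonneg fun _ _ => sq_nonneg _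
    have h := Real.abs_le_sqrt cs
    rw [Real.sqrt_mul hS, Real.sqrt_sq hN] at h
    have h2 := mul_le_mul_of_nonneg_right (hm i) hN
    linarith [neg_abs_le (∑ j, ∑ k, 𝓕 i j k * (y j * y k))]
  have e : triForm 𝓕 x y y = ∑ i, x i * ∑ j, ∑ k, 𝓕 i j k * (y j * y k) := by
    unfold triForm
    simp only [Finset.mul_sum]
    refine Finset.sum_congr rfl fun i _ => Finset.sum_congr rfl fun j _ =>
      Finset.sum_congr rfl fun k _ => by ring
  rw [e]
  calc -(m * ((∑ i, x i) * ∑ j, y j ^ 2)) = ∑ i, x i * -(m * ∑ j, y j ^ 2) := by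
        rw [← Finset.sum_mul]; ring
    _ ≤ _ := Finset.sum_le_sum fun i _ => mul_le_mul_of_nonneg_left (key i) (hx i)

theorem epsVec_sum {ι : Type*} [Fintype ι] [DecidableEq ι] (ε : ℝ) (i : ι) (x : ι → ℝ) :
    ∑ j, epsVec ε i j * x j = ε * (∑ j, x j) + (1 - ε) * x i := by
  simp only [epsVec, add_mul, Finset.sum_add_distrib, ← Finset.mul_sum, mul_assoc]
  simp

theorem Geps_ge {ι : Type*} [Fintype ι] [DecidableEq ι] (ε : ℝ) (x y : ι → ℝ)
    (h0 : 0 < ε) (h1 : ε < 1) (hx : ∀ i, 0 ≤ x i) :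
    (ε * (1 - ε) ^ 2) * ((∑ i, x i) * ∑ j, y j ^ 2) ≤ Geps ε x y y := by
  unfold Geps
  simp only [epsVec_sum]
  have hs : 0 ≤ ∑ i, x i := Finset.sum_nonneg fun i _ => hx i
  generalize (∑ i, x i) = s at *
  have hε : 0 < 1 - ε := by linarith
  set Y := ∑ j, y j with hY
  have hsq : (1 - ε) ^ 2 * ∑ j, y j ^ 2 ≤ ∑ i, (ε * Y + (1 - ε) * y i) ^ 2 := by
    have : ∑ i, (ε * Y + (1 - ε) * y i) ^ 2
        = ∑ _i : ι, (ε * Y) ^ 2 + 2 * ε * (1 - ε) * Y * Y + (1 - ε) ^ 2 * ∑ j, y j ^ 2 := by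
      conv_rhs => rw [mul_assoc _ Y Y]; enter [1, 2, 2, 2]; rw [hY]
      simp only [Finset.mul_sum, ← Finset.sum_add_distrib]
      exact Finset.sum_congr rfl fun i _ => by ring
    rw [this]
    have a : 0 ≤ ∑ _i : ι, (ε * Y) ^ 2 := Finset.sum_nonneg fun _ _ => sq_nonneg _
    have b : 0 ≤ 2 * ε * (1 - ε) * Y * Y := by
      rw [mul_assoc _ Y Y]
      exact mul_nonneg (by positivity) (mul_self_nonneg Y)
    linarith
  calc _ = ε * s * ((1 - ε) ^ 2 * ∑ j, y j ^ 2) := by ring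
    _ ≤ ε * s * ∑ i, (ε * Y + (1 - ε) * y i) ^ 2 :=
        mul_le_mul_of_nonneg_left hsq (by positivity)
    _ ≤ _ := by
        rw [Finset.mul_sum]
        refine Finset.sum_le_sum fun i _ => ?_
        have := mul_nonneg (mul_nonneg hε.le (hx i)) (sq_nonneg (ε * Y + (1 - ε) * y i))
        linarith

/-- General-`ε` convexification bound (proof of Proposition 3.4): if `0 < ε < 1` and
`α ≥ (1/(ε(1−ε)²))·max_i sqrt(∑_{j,k} 𝓕_{ijk}²)`, then
`F(x,y,y) + α·G_ε(x,y,y) ≥ 0` for every assignment vector `x ∈ M` and every `y ∈ ℝⁿ`. -/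
theorem general_eps_convexification {n₁ n₂ : ℕ} (h₁ : 1 ≤ n₁) (h₁₂ : n₁ ≤ n₂)
    (𝓕 : (Fin n₁ × Fin n₂) → (Fin n₁ × Fin n₂) → (Fin n₁ × Fin n₂) → ℝ)
    (hsym₁ : ∀ i j k, 𝓕 i j k = 𝓕 j i k)
    (hsym₂ : ∀ i j k, 𝓕 i j k = 𝓕 i k j)
    (ε : ℝ) (hε0 : 0 < ε) (hε1 : ε < 1)
    (α : ℝ)
    (hα : (1 / (ε * (1 - ε) ^ 2)) *
        (Finset.univ.sup'
          (Finset.univ_nonempty_iff.mpr ⟨(⟨0, h₁⟩, ⟨0, h₁.trans h₁₂⟩)⟩)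
          fun i => Real.sqrt (∑ j, ∑ k, (𝓕 i j k) ^ 2)) ≤ α) :
    ∀ x ∈ assignSet n₁ n₂, ∀ y : Fin n₁ × Fin n₂ → ℝ,
      0 ≤ triForm 𝓕 x y y + α * Geps ε x y y := by
  intro x hx y
  obtain ⟨hbin, -, -⟩ := hx
  have hx0 : ∀ p, 0 ≤ x p := fun p => by rcases hbin p with h | h <;> simp [h]
  set m := (Finset.univ.sup'
          (Finset.univ_nonempty_iff.mpr ⟨(⟨0, h₁⟩, ⟨0, h₁.trans h₁₂⟩)⟩)
          fun i => Real.sqrt (∑ j, ∑ k, (𝓕 i j k) ^ 2)) with hm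
  have hmi : ∀ i, Real.sqrt (∑ j, ∑ k, (𝓕 i j k) ^ 2) ≤ m := fun i =>
    Finset.le_sup' (fun i => Real.sqrt (∑ j, ∑ k, (𝓕 i j k) ^ 2)) (Finset.mem_univ i)
  clear_value m
  have hm0 : 0 ≤ m := (Real.sqrt_nonneg _).trans (hmi (⟨0, h₁⟩, ⟨0, h₁.trans h₁₂⟩))
  have hc : 0 < ε * (1 - ε) ^ 2 := by
    have : 0 < 1 - ε := by linarith
    positivity
  have hα0 : 0 ≤ α := le_trans (by positivity) hα
  have hmα : m ≤ α * (ε * (1 - ε) ^ 2) := by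
    rw [one_div, inv_mul_le_iff₀ hc] at hα
    linarith
  have hF := triForm_ge 𝓕 x y m hx0 hmi
  have hG := Geps_ge ε x y hε0 hε1 hx0
  have hs : 0 ≤ (∑ i, x i) * ∑ j, y j ^ 2 :=
    mul_nonneg (Finset.sum_nonneg fun i _ => hx0 i) (Finset.sum_nonneg fun i _ => sq_nonneg _)
  have h1 := mul_le_mul_of_nonneg_left hG hα0
  have h2 := mul_le_mul_of_nonneg_right hmα hs
  nlinarith
end

section
/- Proposition 3.8 (part 2): let 𝓕 be a symmetric third-order tensor on ℝⁿ with trilinear form F, let G be the modification trilinear form built from the vectors ē_i = (1/3)𝟙 + (2/3)e_i, and set F_α = F + α·G. For every non-homogeneous tuple (x,y,z) ∈ M³ (i.e. x ≠ y or y ≠ z or z ≠ x), the inequality F_α(x,y,z) ≤ max_{u∈{x,y,z}} F_α(u,u,u) holds if and only if α ≥ Λ(x,y,z) := (F(x,y,z) − max_{u∈{x,y,z}} F(u,u,u)) / (G(x,x,x) − G(x,y,z)); here the denominator G(x,x,x) − G(x,y,z) is strictly positive. -/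
open Finset

theorem aux_inner {n₁ n₂ : ℕ} (x : Fin n₁ × Fin n₂ → ℝ) (hx : x ∈ assignSet n₁ n₂)
    (i : Fin n₁ × Fin n₂) :
    ∑ j, epsVec (1 / 3) i j * x j = (n₁ : ℝ) / 3 + 2 / 3 * x i := by
  have hs : ∑ p, x p = (n₁ : ℝ) := by
    rw [Fintype.sum_prod_type, Finset.sum_congr rfl (fun i _ => hx.2.1 i)]
    simp
  have h : ∀ j, epsVec (1 / 3) i j * x j
      = 1 / 3 * x j + 2 / 3 * (if j = i then x j else 0) := by
    intro j
    unfold epsVec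
    split_ifs <;> ring
  simp only [h]
  rw [Finset.sum_add_distrib, ← Finset.mul_sum, ← Finset.mul_sum, hs]
  simp
  ring

theorem aux_diag {n₁ n₂ : ℕ} (x : Fin n₁ × Fin n₂ → ℝ) (hx : x ∈ assignSet n₁ n₂) :
    Geps (1 / 3) x x x = ∑ _i : Fin n₁ × Fin n₂, ((n₁ : ℝ) / 3) ^ 3
      + (((n₁ : ℝ) / 3 + 2 / 3) ^ 3 - ((n₁ : ℝ) / 3) ^ 3) * n₁ := by
  have hs : ∑ p, x p = (n₁ : ℝ) := by
    rw [Fintype.sum_prod_type, Finset.sum_congr rfl (fun i _ => hx.2.1 i)]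
    simp
  unfold Geps
  simp only [aux_inner x hx]
  conv_rhs => rw [← hs, Finset.mul_sum, ← Finset.sum_add_distrib]
  rw [hs]
  refine Finset.sum_congr rfl fun i _ => ?_
  rcases hx.1 i with h | h <;> rw [h] <;> ring

theorem aux_pos {n₁ n₂ : ℕ} (h₁ : 1 ≤ n₁) (x y z : Fin n₁ × Fin n₂ → ℝ)
    (hx : x ∈ assignSet n₁ n₂) (hy : y ∈ assignSet n₁ n₂) (hz : z ∈ assignSet n₁ n₂)
    (hnh : x ≠ y ∨ y ≠ z ∨ z ≠ x) :
    0 < Geps (1 / 3) x x x + Geps (1 / 3) y y y + Geps (1 / 3) z z z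
      - 3 * Geps (1 / 3) x y z := by
  have hn : (1 : ℝ) ≤ n₁ := by exact_mod_cast h₁
  have nn : ∀ u ∈ assignSet n₁ n₂, ∀ i, 0 ≤ u i := by
    intro u hu i
    rcases hu.1 i with h | h <;> rw [h] <;> norm_num
  have hp : ∃ p, x p ≠ y p ∨ y p ≠ z p ∨ z p ≠ x p := by
    rcases hnh with h | h | h
    all_goals
      obtain ⟨p, hp⟩ := Function.ne_iff.mp h
      exact ⟨p, by tauto⟩
  unfold Geps
  simp only [aux_inner x hx, aux_inner y hy, aux_inner z hz]
  rw [Finset.mul_sum, ← Finset.sum_add_distrib, ← Finset.sum_add_distrib,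
    ← Finset.sum_sub_distrib]
  have key : ∀ s a b c : ℝ, (s + 2 / 3 * a) * (s + 2 / 3 * a) * (s + 2 / 3 * a)
      + (s + 2 / 3 * b) * (s + 2 / 3 * b) * (s + 2 / 3 * b)
      + (s + 2 / 3 * c) * (s + 2 / 3 * c) * (s + 2 / 3 * c)
      - 3 * ((s + 2 / 3 * a) * (s + 2 / 3 * b) * (s + 2 / 3 * c))
      = 2 / 9 * (3 * s + 2 / 3 * (a + b + c)) *
        ((a - b) ^ 2 + (b - c) ^ 2 + (c - a) ^ 2) := by
    intros; ring
  simp only [key]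
  have hc : ∀ i, 0 < 2 / 9 * (3 * ((n₁ : ℝ) / 3) + 2 / 3 * (x i + y i + z i)) := by
    intro i
    have := nn x hx i
    have := nn y hy i
    have := nn z hz i
    linarith
  refine Finset.sum_pos' (fun i _ => mul_nonneg (hc i).le (by positivity)) ?_
  obtain ⟨p, hp⟩ := hp
  refine ⟨p, Finset.mem_univ _, mul_pos (hc p) ?_⟩
  rcases hp with h | h | h
  all_goals
    have := pow_pos (abs_pos.mpr (sub_ne_zero.mpr h)) 2
    rw [sq_abs] at this
    nlinarith [sq_nonneg (x p - y p), sq_nonneg (y p - z p), sq_nonneg (z p - x p)]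

/-- Proposition 3.8 (part 2): with `F_α = F + α·G` (`G = G_{1/3}`), for every
non-homogeneous tuple `(x,y,z) ∈ M³` the inequality
`F_α(x,y,z) ≤ max_{u ∈ {x,y,z}} F_α(u,u,u)` holds iff
`α ≥ Λ(x,y,z) = (F(x,y,z) − max_{u∈{x,y,z}} F(u,u,u)) / (G(x,x,x) − G(x,y,z))`,
where the denominator is strictly positive. -/
theorem prop38_part2 {n₁ n₂ : ℕ} (h₁ : 1 ≤ n₁) (h₁₂ : n₁ ≤ n₂)
    (𝓕 : (Fin n₁ × Fin n₂) → (Fin n₁ × Fin n₂) → (Fin n₁ × Fin n₂) → ℝ)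
    (hsym₁ : ∀ i j k, 𝓕 i j k = 𝓕 j i k)
    (hsym₂ : ∀ i j k, 𝓕 i j k = 𝓕 i k j)
    (α : ℝ)
    (x y z : Fin n₁ × Fin n₂ → ℝ)
    (hx : x ∈ assignSet n₁ n₂) (hy : y ∈ assignSet n₁ n₂) (hz : z ∈ assignSet n₁ n₂)
    (hnh : x ≠ y ∨ y ≠ z ∨ z ≠ x) :
    0 < Geps (1 / 3) x x x - Geps (1 / 3) x y z ∧
      ((triForm 𝓕 x y z + α * Geps (1 / 3) x y z ≤
          max (triForm 𝓕 x x x + α * Geps (1 / 3) x x x)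
            (max (triForm 𝓕 y y y + α * Geps (1 / 3) y y y)
              (triForm 𝓕 z z z + α * Geps (1 / 3) z z z)))
        ↔ (triForm 𝓕 x y z -
              max (triForm 𝓕 x x x) (max (triForm 𝓕 y y y) (triForm 𝓕 z z z))) /
            (Geps (1 / 3) x x x - Geps (1 / 3) x y z) ≤ α) := by
  have hp := aux_pos h₁ x y z hx hy hz hnh
  have e1 : Geps (1 / 3) y y y = Geps (1 / 3) x x x := by
    rw [aux_diag x hx, aux_diag y hy]
  have e2 : Geps (1 / 3) z z z = Geps (1 / 3) x x x := by
    rw [aux_diag x hx, aux_diag z hz]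
  rw [e1, e2] at hp ⊢
  have hd : 0 < Geps (1 / 3) x x x - Geps (1 / 3) x y z := by linarith
  refine ⟨hd, ?_⟩
  rw [max_add_add_right, max_add_add_right, div_le_iff₀ hd]
  constructor <;> intro h <;> linarith
end
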